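/- Let w ∈ A*_p(dx) on ℝⁿ for 1 < p < ∞ (Lebesgue measure), σ = w^{1−p'}, N = ‖M_s‖_{L^{p'}(σ)}, and let 1 < s < N/(N−1). Then for every axis-parallel rectangle R: (1/|R|)∫_R w^s dx ≤ (s/(1 − (s−1)(N−1))) · ( (1/|R|)∫_R w dx )^s. -/

import Mathlib

open MeasureTheory Set ENNReal
noncomputable section

/-- An axis-parallel rectangle in `ℝⁿ`: a product of nondegenerate bounded closed intervals. -/
def IsRectangle {n : ℕ} (R : Set (Fin n → ℝ)) : Prop :=
  ∃ a b : Fin n → ℝ, (∀ i, a i < b i) ∧ R = Set.univ.pi fun i => Set.Icc (a i) (b i)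

/-- The average `(1/μ R) ∫_R f dμ`. -/
def rAvg {n : ℕ} (μ : Measure (Fin n → ℝ)) (f : (Fin n → ℝ) → ℝ)
    (R : Set (Fin n → ℝ)) : ℝ :=
  (μ R).toReal⁻¹ * ∫ x in R, f x ∂μ

/-- The strong maximal function with respect to `μ`: supremum of averages of `|f|`
over axis-parallel rectangles of positive measure containing `x`. -/
def strongMaximal {n : ℕ} (μ : Measure (Fin n → ℝ)) (f : (Fin n → ℝ) → ℝ)
    (x : Fin n → ℝ) : ℝ :=
  ⨆ R : {R : Set (Fin n → ℝ) // IsRectangle R ∧ x ∈ R ∧ μ R ≠ 0},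
    rAvg μ (fun y => |f y|) R.1

/-- `w` belongs to the strong Muckenhoupt class `A*_p(μ)` with constant (bound) `c`. -/
def IsAStarP {n : ℕ} (μ : Measure (Fin n → ℝ)) (w : (Fin n → ℝ) → ℝ) (p c : ℝ) : Prop :=
  ∀ R : Set (Fin n → ℝ), IsRectangle R → μ R ≠ 0 →
    rAvg μ w R * (rAvg μ (fun x => w x ^ (1 - p / (p - 1))) R) ^ (p - 1) ≤ c


/-- The operator norm of the strong maximal function (taken with respect to the
measure `ν`) acting on `L^q` of the measure `m`. -/
def opNormMs {n : ℕ} (ν m : Measure (Fin n → ℝ)) (q : ℝ) : ℝ≥0∞ :=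
  sInf {c : ℝ≥0∞ | ∀ f : (Fin n → ℝ) → ℝ,
    eLpNorm (strongMaximal ν f) (ENNReal.ofReal q) m ≤
      c * eLpNorm f (ENNReal.ofReal q) m}

theorem le_of_local_decrease {a b δ : ℝ} {H : ℝ → ℝ} {K : Set ℝ} (hδ : 0 < δ)
    (hH : Continuous H) (hK : IsCompact K) (hne : K.Nonempty) (hKab : K ⊆ Icc a b)
    (hstep : ∀ u v, a ≤ u → u < v → v ≤ b → (u ∈ K ∨ v ∈ K) →
      (v - u < δ ∨ ∀ x ∈ Ioo u v, x ∉ K) → H v ≤ H u) :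
    H b ≤ H a := by
  obtain ⟨c₀, hc₀, hmin⟩ := hK.exists_isLeast hne
  obtain ⟨c₁, hc₁, hmax⟩ := hK.exists_isGreatest hne
  have h0 : H c₀ ≤ H a := by
    rcases (hKab hc₀).1.eq_or_lt with h | h
    · rw [h]
    · exact hstep _ _ le_rfl h (hKab hc₀).2 (Or.inr hc₀)
        (Or.inr fun x hx hxK => (hmin hxK).not_gt hx.2)
  have h1 : H b ≤ H c₁ := by
    rcases (hKab hc₁).2.eq_or_lt with h | h
    · rw [h]
    · exact hstep _ _ (hKab hc₁).1 h le_rfl (Or.inl hc₁)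
        (Or.inr fun x hx hxK => (hmax hxK).not_gt hx.1)
  have hS : IsCompact (K ∩ {x | H x ≤ H c₀}) :=
    hK.inter_right (isClosed_le hH continuous_const)
  obtain ⟨m, ⟨hmK, hmH⟩, hm⟩ := hS.exists_isGreatest ⟨c₀, hc₀, le_refl (H c₀)⟩
  have hmH : H m ≤ H c₀ := hmH
  rcases (hmax hmK).eq_or_lt with h | h
  · rw [← h] at h1; linarith
  exfalso
  by_cases hx : ∃ x ∈ K, m < x ∧ x < m + δ
  · obtain ⟨x, hxK, hmx, hxδ⟩ := hx
    have := hstep m x (hKab hmK).1 hmx (hKab hxK).2 (Or.inl hmK) (Or.inl (by linarith))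
    exact (hm ⟨hxK, this.trans hmH⟩).not_gt hmx
  · push Not at hx
    obtain ⟨x, ⟨hxK, hxm⟩, hxmin⟩ := (hK.inter_right (isClosed_Ici (a := m + δ))).exists_isLeast
      ⟨c₁, hc₁, hx _ hc₁ h⟩
    have hmx : m < x := by have : m + δ ≤ x := hxm; linarith
    have := hstep m x (hKab hmK).1 hmx (hKab hxK).2 (Or.inl hmK)
      (Or.inr fun y hy hyK => (hxmin ⟨hyK, hx y hyK hy.1⟩).not_gt hy.2)
    exact (hm ⟨hxK, this.trans hmH⟩).not_gt hmx

theorem mem_Icc_update_iff {n : ℕ} {c d y : Fin n → ℝ} {i : Fin n} {u v : ℝ}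
    (hu : c i ≤ u) (hv : v ≤ d i) :
    y ∈ Icc (Function.update c i u) (Function.update d i v) ↔
      y ∈ Icc c d ∧ u ≤ y i ∧ y i ≤ v := by
  simp only [mem_Icc, update_le_iff, le_update_iff]
  constructor
  · rintro ⟨⟨h1, h2⟩, h3, h4⟩
    refine ⟨⟨fun j => ?_, fun j => ?_⟩, h1, h3⟩
    · rcases eq_or_ne j i with rfl | hj
      · exact hu.trans h1
      · exact h2 j hj
    · rcases eq_or_ne j i with rfl | hj
      · exact h3.trans hv
      · exact h4 j hj
  · rintro ⟨⟨h1, h2⟩, h3, h4⟩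
    exact ⟨⟨h3, fun j _ => h1 j⟩, h4, fun j _ => h2 j⟩

theorem ae_coord_ne {n : ℕ} (i : Fin n) (x : ℝ) : ∀ᵐ y : Fin n → ℝ, y i ≠ x := by
  have h := Measure.pi_hyperplane (fun _ : Fin n => (volume : Measure ℝ)) i x
  rw [← volume_pi] at h
  exact measure_eq_zero_iff_ae_notMem.1 h

/-- A primitive of an integrable function in a coordinate direction is continuous. -/
theorem continuous_setIntegral_coord_le {n : ℕ} {φ : (Fin n → ℝ) → ℝ} {Q : Set (Fin n → ℝ)}
    (hφ : IntegrableOn φ Q) (i : Fin n) :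
    Continuous fun x : ℝ => ∫ y in Q, {y : Fin n → ℝ | y i ≤ x}.indicator φ y := by
  have hm : ∀ x : ℝ, MeasurableSet {y : Fin n → ℝ | y i ≤ x} := fun x =>
    measurableSet_le (measurable_pi_apply i) measurable_const
  refine continuous_iff_continuousAt.2 fun x₀ => ?_
  refine continuousAt_of_dominated (bound := fun y => ‖φ y‖)
    (.of_forall fun x => hφ.aestronglyMeasurable.indicator (hm x))
    (.of_forall fun x => .of_forall fun y => norm_indicator_le_norm_self _ _) hφ.norm ?_
  filter_upwards [ae_restrict_of_ae (ae_coord_ne i x₀)] with y hy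
  rcases lt_or_gt_of_ne hy with h | h
  · refine (continuousAt_const (y := φ y)).congr ?_
    filter_upwards [lt_mem_nhds h] with x hx
    exact (indicator_of_mem (s := {y : Fin n → ℝ | y i ≤ x}) hx.le φ).symm
  · refine (continuousAt_const (y := (0 : ℝ))).congr ?_
    filter_upwards [gt_mem_nhds h] with x hx
    exact (indicator_of_notMem (s := {y : Fin n → ℝ | y i ≤ x}) (not_le.2 hx) φ).symm

/-- If `φ` has nonpositive integral over those rectangles not contained in `E` that are small, and
over those whose slices orthogonal to a coordinate axis lie in `E` apart from the two end slices,
then it has nonpositive integral over all rectangles not contained in `E`. -/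
theorem setIntegral_Icc_nonpos_of_small {n : ℕ} {a b : Fin n → ℝ} {E U : Set (Fin n → ℝ)}
    {φ : (Fin n → ℝ) → ℝ} {δ : ℝ} (hδ : 0 < δ) (hU : IsOpen U) (hE : E = Icc a b ∩ U)
    (hφ : IntegrableOn φ (Icc a b))
    (hsmall : ∀ c d : Fin n → ℝ, Icc c d ⊆ Icc a b → ¬ Icc c d ⊆ E →
      (∀ i, d i - c i < δ) → ∫ y in Icc c d, φ y ≤ 0)
    (hfull : ∀ c d : Fin n → ℝ, (∀ i, c i < d i) → Icc c d ⊆ Icc a b → ¬ Icc c d ⊆ E →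
      (∃ i, ∀ y ∈ Icc c d, y i ≠ c i → y i ≠ d i → y ∈ E) → ∫ y in Icc c d, φ y ≤ 0)
    (T : Finset (Fin n)) : ∀ c d : Fin n → ℝ, (∀ i, c i < d i) → Icc c d ⊆ Icc a b →
      ¬ Icc c d ⊆ E → (∀ i ∉ T, d i - c i < δ) → ∫ y in Icc c d, φ y ≤ 0 := by
  induction T using Finset.induction_on with
  | empty => exact fun c d _ hs hn h => hsmall c d hs hn fun i => h i (by simp)
  | insert i T _ ih =>
    intro c d hcd hs hn hT
    have hφQ := hφ.mono_set hs
    set H : ℝ → ℝ := fun x => ∫ y in Icc c d, {y : Fin n → ℝ | y i ≤ x}.indicator φ y with hH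
    have hHc : H (c i) = 0 := by
      refine integral_eq_zero_of_ae ?_
      filter_upwards [ae_restrict_of_ae (ae_coord_ne i (c i)),
        ae_restrict_mem measurableSet_Icc] with y hy hyQ
      exact indicator_of_notMem (s := {y : Fin n → ℝ | y i ≤ c i})
        (fun h => hy (le_antisymm h (hyQ.1 i))) φ
    have hHd : H (d i) = ∫ y in Icc c d, φ y :=
      setIntegral_congr_fun measurableSet_Icc fun y hy =>
        indicator_of_mem (s := {y : Fin n → ℝ | y i ≤ d i}) (hy.2 i) φ
    rw [← hHd, ← hHc]
    have hslab : ∀ u v, c i ≤ u → u < v → v ≤ d i →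
        H v - H u = ∫ y in Icc (Function.update c i u) (Function.update d i v), φ y := by
      intro u v hu huv hv
      have hm : ∀ x : ℝ, MeasurableSet {y : Fin n → ℝ | y i ≤ x} := fun x =>
        measurableSet_le (measurable_pi_apply i) measurable_const
      rw [hH]
      dsimp only
      rw [← integral_sub (hφQ.indicator (hm v)) (hφQ.indicator (hm u)),
        ← integral_indicator measurableSet_Icc, ← integral_indicator measurableSet_Icc]
      refine integral_congr_ae ?_
      filter_upwards [ae_coord_ne i u] with y hy
      have hmem := mem_Icc_update_iff hu hv (y := y)
      by_cases hQ : y ∈ Icc c d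
      · rcases lt_or_gt_of_ne hy with h | h
        · simp [indicator, hmem, hQ, h.le, h.not_ge, (h.trans huv).le]
        · simp [indicator, hmem, hQ, h.le, h.not_ge]
      · simp [indicator, hmem, hQ]
    set K : Set ℝ := (fun y : Fin n → ℝ => y i) '' (Icc c d \ E) with hKdef
    have hdiff : Icc c d \ E = Icc c d ∩ Uᶜ := by
      ext y
      simp only [hE, mem_sdiff, mem_inter_iff, mem_compl_iff, not_and]
      exact ⟨fun h => ⟨h.1, h.2 (hs h.1)⟩, fun h => ⟨h.1, fun _ => h.2⟩⟩
    have hK : IsCompact K := by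
      rw [hKdef, hdiff]
      exact (isCompact_Icc.inter_right hU.isClosed_compl).image (continuous_apply i)
    have hKne : K.Nonempty := (sdiff_nonempty.2 hn).image _
    refine le_of_local_decrease hδ (continuous_setIntegral_coord_le hφQ i) hK hKne ?_ ?_
    · rintro _ ⟨y, hy, rfl⟩
      exact ⟨hy.1.1 i, hy.1.2 i⟩
    intro u v hu huv hv hmemK hcase
    rw [← sub_nonpos, hslab u v hu huv hv]
    have hsub : Icc (Function.update c i u) (Function.update d i v) ⊆ Icc c d :=
      fun y hy => ((mem_Icc_update_iff hu hv).1 hy).1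
    have hlt : ∀ j, Function.update c i u j < Function.update d i v j := by
      intro j
      rcases eq_or_ne j i with rfl | hj
      · simpa using huv
      · simpa [hj] using hcd j
    have hmem : ∀ y ∈ Icc c d, u ≤ y i → y i ≤ v →
        y ∈ Icc (Function.update c i u) (Function.update d i v) := fun y hy h1 h2 =>
      (mem_Icc_update_iff hu hv).2 ⟨hy, h1, h2⟩
    have hnot : ¬ Icc (Function.update c i u) (Function.update d i v) ⊆ E := by
      rcases hmemK with ⟨y, hy, hyu⟩ | ⟨y, hy, hyv⟩
      · exact fun h => hy.2 (h (hmem y hy.1 hyu.ge (hyu.le.trans huv.le)))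
      · exact fun h => hy.2 (h (hmem y hy.1 (huv.le.trans hyv.ge) hyv.le))
    rcases hcase with hshort | hgap
    · refine ih _ _ hlt (hsub.trans hs) hnot fun j hj => ?_
      rcases eq_or_ne j i with rfl | hji
      · simpa using hshort
      · simpa [hji] using hT j (by simp [hji, hj])
    · refine hfull _ _ hlt (hsub.trans hs) hnot ⟨i, fun y hy hyu hyv => ?_⟩
      by_contra hyE
      simp only [Function.update_self] at hyu hyv
      have h1 : u ≤ y i := by simpa using hy.1 i
      have h2 : y i ≤ v := by simpa using hy.2 i
      exact hgap (y i) ⟨lt_of_le_of_ne h1 (Ne.symm hyu), lt_of_le_of_ne h2 hyv⟩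
        ⟨y, ⟨hsub hy, hyE⟩, rfl⟩

/-- Let `E` be relatively open in a rectangle `R`. If `g` has nonpositive integral over `R` and over
each rectangle in `R` not contained in `E`, then it has nonpositive integral over `E`. -/
theorem setIntegral_nonpos_of_rectangles {n : ℕ} {a b : Fin n → ℝ} (hab : ∀ i, a i < b i)
    {E U : Set (Fin n → ℝ)} {g : (Fin n → ℝ) → ℝ} (hU : IsOpen U) (hE : E = Icc a b ∩ U)
    (hg : IntegrableOn g (Icc a b)) (hgR : ∫ y in Icc a b, g y ≤ 0)
    (hgQ : ∀ c d : Fin n → ℝ, (∀ i, c i < d i) → Icc c d ⊆ Icc a b → ¬ Icc c d ⊆ E →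
      ∫ y in Icc c d, g y ≤ 0) :
    ∫ y in E, g y ≤ 0 := by
  have hER : E ⊆ Icc a b := hE ▸ inter_subset_left
  have hEm : MeasurableSet E := hE ▸ measurableSet_Icc.inter hU.measurableSet
  by_cases hsub : Icc a b ⊆ E
  · rwa [hER.antisymm hsub]
  have hEg : IntegrableOn g E := hg.mono_set hER
  have hbound : ∀ δ : ℝ, 0 < δ →
      ∫ y in E, g y ≤ ∫ y in E ∩ Metric.thickening δ (Icc a b \ E), |g y| := by
    intro δ hδ
    set D := E ∩ Metric.thickening δ (Icc a b \ E) with hD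
    have hDm : MeasurableSet D := hEm.inter Metric.isOpen_thickening.measurableSet
    have hiE : IntegrableOn (E.indicator g) (Icc a b) := hg.indicator hEm
    have hiD : IntegrableOn (D.indicator fun y => |g y|) (Icc a b) := hg.abs.indicator hDm
    have hD0 : ∀ y, 0 ≤ D.indicator (fun y => |g y|) y :=
      fun y => indicator_nonneg (fun _ _ => abs_nonneg _) _
    have key : ∫ y in Icc a b, (E.indicator g y - D.indicator (fun y => |g y|) y) ≤ 0 := by
      refine setIntegral_Icc_nonpos_of_small hδ hU hE (hiE.sub hiD) ?_ ?_ Finset.univ a b hab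
        subset_rfl hsub (by simp)
      · intro c d hs hn hlt
        refine setIntegral_nonpos measurableSet_Icc fun y hy => ?_
        rw [Pi.sub_apply]
        by_cases hyE : y ∈ E
        · obtain ⟨z, hz, hzE⟩ := not_subset.1 hn
          have hyD : y ∈ D := by
            refine ⟨hyE, Metric.mem_thickening_iff.2 ⟨z, ⟨hs hz, hzE⟩, ?_⟩⟩
            refine (dist_pi_lt_iff hδ).2 fun i => ?_
            rw [Real.dist_eq, abs_lt]
            have := hlt i
            have := hy.1 i
            have := hy.2 i
            have := hz.1 i
            have := hz.2 i
            constructor <;> linarith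
          rw [indicator_of_mem hyE, indicator_of_mem hyD]
          linarith [le_abs_self (g y)]
        · rw [indicator_of_notMem hyE]
          linarith [hD0 y]
      · rintro c d hcd hs hn ⟨i, hi⟩
        calc ∫ y in Icc c d, (E.indicator g y - D.indicator (fun y => |g y|) y)
            ≤ ∫ y in Icc c d, E.indicator g y :=
              integral_mono ((hiE.sub hiD).mono_set hs) (hiE.mono_set hs)
                fun y => sub_le_self _ (hD0 y)
          _ = ∫ y in Icc c d, g y := by
              refine integral_congr_ae ?_
              filter_upwards [ae_restrict_of_ae (ae_coord_ne i (c i)),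
                ae_restrict_of_ae (ae_coord_ne i (d i)),
                ae_restrict_mem measurableSet_Icc] with y h1 h2 h3
              exact indicator_of_mem (hi y h3 h1 h2) _
          _ ≤ 0 := hgQ c d hcd hs hn
    rw [integral_sub hiE hiD, setIntegral_indicator hEm, setIntegral_indicator hDm,
      inter_eq_right.2 hER, inter_eq_right.2 (inter_subset_left.trans hER)] at key
    linarith
  have hlim := tendsto_setIntegral_of_antitone (μ := volume) (f := fun y => |g y|)
    (s := fun k : ℕ => E ∩ Metric.thickening (1 / ((k : ℝ) + 1)) (Icc a b \ E))
    (fun k => hEm.inter Metric.isOpen_thickening.measurableSet)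
    (fun k l hkl => inter_subset_inter_right _
      (Metric.thickening_mono (one_div_le_one_div_of_le (by positivity) (by gcongr)) _))
    ⟨0, (hEg.mono_set inter_subset_left).abs⟩
  have hempty : ⋂ k : ℕ, E ∩ Metric.thickening (1 / ((k : ℝ) + 1)) (Icc a b \ E) = ∅ := by
    refine eq_empty_iff_forall_notMem.2 fun y hy => ?_
    rw [mem_iInter] at hy
    have hcl : IsClosed (Icc a b \ E) := by
      rw [hE, sdiff_self_inter]
      exact isClosed_Icc.sdiff hU
    have : y ∈ closure (Icc a b \ E) := by
      rw [Metric.closure_eq_iInter_thickening]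
      refine mem_iInter₂.2 fun δ hδ => ?_
      obtain ⟨k, hk⟩ := exists_nat_one_div_lt hδ
      exact Metric.thickening_mono hk.le _ (hy k).2
    rw [hcl.closure_eq] at this
    exact this.2 (hy 0).1
  rw [hempty, setIntegral_empty] at hlim
  exact ge_of_tendsto' hlim fun k => hbound _ (by positivity)

/-- Layer-cake formula for a power of a truncated function integrated against a density. -/
theorem lintegral_mul_min_rpow {α : Type*} [MeasurableSpace α] {μ : Measure α}
    {v G : α → ℝ≥0∞} (hv : Measurable v) (hG : Measurable G) (T : ℝ) {q : ℝ} (hq : 0 < q) :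
    ∫⁻ x, v x * min (G x) (ENNReal.ofReal T) ^ q ∂μ = ENNReal.ofReal q *
      ∫⁻ t in Ioi (0 : ℝ), (Iio T).indicator
        (fun t => (∫⁻ x in {x | ENNReal.ofReal t < G x}, v x ∂μ) * ENNReal.ofReal (t ^ (q - 1))) t := by
  set f : α → ℝ := fun x => (min (G x) (ENNReal.ofReal T)).toReal with hf
  have hne : ∀ x, min (G x) (ENNReal.ofReal T) ≠ ∞ := fun x =>
    ne_top_of_le_ne_top ofReal_ne_top (min_le_right _ _)
  have hfm : Measurable f := (hG.min measurable_const).ennreal_toReal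
  have h := lintegral_rpow_eq_lintegral_meas_lt_mul (μ.withDensity v) (f := f)
    (.of_forall fun x => toReal_nonneg) hfm.aemeasurable hq
  rw [lintegral_withDensity_eq_lintegral_mul _ hv (by fun_prop)] at h
  have h1 : ∀ x, v x * min (G x) (ENNReal.ofReal T) ^ q
      = (v * fun x => ENNReal.ofReal (f x ^ q)) x := fun x => by
    simp only [Pi.mul_apply, hf]
    rw [toReal_rpow, ofReal_toReal (rpow_ne_top_of_nonneg hq.le (hne x))]
  rw [lintegral_congr h1, h]
  congr 1
  refine setLIntegral_congr_fun measurableSet_Ioi fun t (ht : 0 < t) => ?_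
  have hset : {x | t < f x} = {x | ENNReal.ofReal t < G x ∧ t < T} := by
    ext x
    change t < f x ↔ ENNReal.ofReal t < G x ∧ t < T
    rw [hf, ← ofReal_lt_iff_lt_toReal ht.le (hne x), lt_min_iff, ofReal_lt_ofReal_iff']
    exact ⟨fun h => ⟨h.1, h.2.1⟩, fun h => ⟨h.1, h.2, ht.trans h.2⟩⟩
  by_cases htT : t < T
  · rw [indicator_of_mem (show t ∈ Iio T from htT), withDensity_apply _
      (measurableSet_lt measurable_const hfm), hset]
    simp [htT]
  · rw [indicator_of_notMem (show t ∉ Iio T from htT), hset]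
    simp [htT]

/-- A self-improving estimate: if, on the superlevel sets of `G ≥ w`, the integral of `G` is
controlled by that of `w` and the mean of `w` is at most the level, then `w` has higher
integrability. -/
theorem lintegral_rpow_le_of_superlevel {α : Type*} [MeasurableSpace α] {μ : Measure α}
    [IsFiniteMeasure μ] {w G : α → ℝ≥0∞} (hw : Measurable w) (hG : Measurable G)
    (hwtop : ∀ x, w x ≠ ∞) (hwG : w ≤ᵐ[μ] G) {L N s : ℝ} (hL : 0 < L) (hN : 0 ≤ N) (hs : 1 < s)
    (hNs : 0 < s - N * (s - 1)) (hwL : ∫⁻ x, w x ∂μ = ENNReal.ofReal L * μ univ)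
    (hGw : ∀ t : ℝ, ∫⁻ x in {x | ENNReal.ofReal t < G x}, G x ∂μ ≤
      ENNReal.ofReal N * ∫⁻ x in {x | ENNReal.ofReal t < G x}, w x ∂μ)
    (hwt : ∀ t : ℝ, L ≤ t → ∫⁻ x in {x | ENNReal.ofReal t < G x}, w x ∂μ ≤
      ENNReal.ofReal t * μ {x | ENNReal.ofReal t < G x}) :
    ENNReal.ofReal (s - N * (s - 1)) * ∫⁻ x, w x ^ s ∂μ ≤
      ENNReal.ofReal (s * L ^ s) * μ univ := by
  have hs0 : 0 < s - 1 := by linarith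
  have htrunc : ∀ T : ℝ, 0 < T → ENNReal.ofReal (s - N * (s - 1)) *
      ∫⁻ x, w x * min (G x) (ENNReal.ofReal T) ^ (s - 1) ∂μ ≤
        ENNReal.ofReal (s * L ^ s) * μ univ := by
    intro T hT
    set W := ∫⁻ x, w x * min (G x) (ENNReal.ofReal T) ^ (s - 1) ∂μ with hW
    set X := ∫⁻ x, 1 * min (G x) (ENNReal.ofReal T) ^ s ∂μ with hX
    have hWtop : W ≠ ∞ := by
      refine ne_top_of_le_ne_top (b := (∫⁻ x, w x ∂μ) * ENNReal.ofReal T ^ (s - 1)) ?_ ?_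
      · rw [hwL]
        exact mul_ne_top (mul_ne_top ofReal_ne_top (measure_ne_top _ _))
          (rpow_ne_top_of_nonneg hs0.le ofReal_ne_top)
      · rw [← lintegral_mul_const _ hw]
        exact lintegral_mono fun x =>
          mul_le_mul_right (rpow_le_rpow (min_le_right _ _) hs0.le) _
    have hXW : X ≤ ENNReal.ofReal N * W := by
      calc X ≤ ∫⁻ x, G x * min (G x) (ENNReal.ofReal T) ^ (s - 1) ∂μ := by
            refine lintegral_mono fun x => ?_
            calc 1 * min (G x) (ENNReal.ofReal T) ^ s
                = min (G x) (ENNReal.ofReal T) * min (G x) (ENNReal.ofReal T) ^ (s - 1) := by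
                  rw [one_mul]
                  conv_lhs => rw [show s = 1 + (s - 1) by ring,
                    rpow_add_of_nonneg _ _ zero_le_one hs0.le, rpow_one]
              _ ≤ _ := by gcongr; exact min_le_left _ _
        _ ≤ ENNReal.ofReal N * W := by
            rw [hW, lintegral_mul_min_rpow hG hG T hs0, lintegral_mul_min_rpow hw hG T hs0,
              mul_left_comm]
            gcongr
            rw [← lintegral_const_mul' _ _ ofReal_ne_top]
            refine lintegral_mono fun t => ?_
            by_cases ht : t ∈ Iio T
            · rw [indicator_of_mem ht, indicator_of_mem ht, ← mul_assoc]
              gcongr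
              exact hGw t
            · simp [indicator_of_notMem ht]
    have hWX : ENNReal.ofReal s * W ≤
        ENNReal.ofReal (s - 1) * X + ENNReal.ofReal (s * L ^ s) * μ univ := by
      have hconst : ENNReal.ofReal (L ^ (s - 1)) * μ univ = ENNReal.ofReal (s - 1) *
          ∫⁻ t in Ioi (0 : ℝ), μ {_x | t < L} * ENNReal.ofReal (t ^ (s - 1 - 1)) := by
        rw [← lintegral_rpow_eq_lintegral_meas_lt_mul μ (f := fun _ => L)
          (.of_forall fun _ => hL.le) aemeasurable_const hs0, lintegral_const]
      have hmeas : Measurable fun t : ℝ =>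
          ENNReal.ofReal L * (μ {_x | t < L} * ENNReal.ofReal (t ^ (s - 1 - 1))) := by
        have : Measurable fun t : ℝ => μ {_x | t < L} := by
          have : (fun t : ℝ => μ {_x | t < L}) = (Iio L).indicator fun _ => μ univ := by
            ext t
            by_cases h : t < L <;> simp [h]
          rw [this]
          exact measurable_const.indicator measurableSet_Iio
        exact (this.mul (by fun_prop)).const_mul _
      have hsplit : W ≤ ENNReal.ofReal (s - 1) * (∫⁻ t in Ioi (0 : ℝ), (Iio T).indicator
          (fun t => (∫⁻ _ in {x | ENNReal.ofReal t < G x}, 1 ∂μ) *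
            ENNReal.ofReal (t ^ (s - 1))) t) +
          ENNReal.ofReal L * (ENNReal.ofReal (L ^ (s - 1)) * μ univ) := by
        rw [hW, lintegral_mul_min_rpow hw hG T hs0, hconst, mul_left_comm, ← mul_add,
          ← lintegral_const_mul' (ENNReal.ofReal L) _ ofReal_ne_top, ← lintegral_add_right _ hmeas]
        gcongr ENNReal.ofReal (s - 1) * ?_
        refine setLIntegral_mono' measurableSet_Ioi fun t (ht : 0 < t) => ?_
        by_cases htT : t ∈ Iio T
        · rw [indicator_of_mem htT, indicator_of_mem htT]
          rcases le_or_gt L t with hLt | htL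
          · refine le_add_right ?_
            have : ENNReal.ofReal (t ^ (s - 1)) =
                ENNReal.ofReal t * ENNReal.ofReal (t ^ (s - 1 - 1)) := by
              rw [← ofReal_mul ht.le]
              congr 1
              conv_lhs => rw [show s - 1 = 1 + (s - 1 - 1) by ring, Real.rpow_add ht, Real.rpow_one]
            rw [this, ← mul_assoc, setLIntegral_one, mul_comm (μ _)]
            gcongr
            exact hwt t hLt
          · refine le_add_left ?_
            rw [← mul_assoc]
            gcongr
            simpa [htL] using (setLIntegral_le_lintegral _ _).trans hwL.le
        · simp [indicator_of_notMem htT]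
      rw [hX, lintegral_mul_min_rpow measurable_const hG T (by linarith : 0 < s)]
      calc ENNReal.ofReal s * W ≤ _ := mul_le_mul_right hsplit _
        _ = _ := by
          rw [mul_add, mul_left_comm]
          congr 1
          rw [← mul_assoc, ← mul_assoc, ← ofReal_mul (by linarith), ← ofReal_mul (by positivity)]
          congr 2
          conv_rhs => rw [show s = 1 + (s - 1) by ring, Real.rpow_add hL, Real.rpow_one]
          ring
    have hle : ENNReal.ofReal s * W ≤ ENNReal.ofReal (N * (s - 1)) * W +
        ENNReal.ofReal (s * L ^ s) * μ univ := by
      refine hWX.trans (add_le_add_left ?_ _)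
      calc ENNReal.ofReal (s - 1) * X ≤ ENNReal.ofReal (s - 1) * (ENNReal.ofReal N * W) := by gcongr
        _ = _ := by rw [← mul_assoc, ← ofReal_mul hs0.le, mul_comm (s - 1)]
    have hfin : ENNReal.ofReal (N * (s - 1)) * W ≠ ∞ := mul_ne_top ofReal_ne_top hWtop
    rw [← ENNReal.add_le_add_iff_left hfin, ← add_mul, ← ofReal_add (by positivity) hNs.le]
    simpa using hle
  have hlim : Filter.Tendsto
      (fun k : ℕ => ENNReal.ofReal (s - N * (s - 1)) *
        ∫⁻ x, w x * min (w x) (ENNReal.ofReal (k + 1)) ^ (s - 1) ∂μ) Filter.atTop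
      (nhds (ENNReal.ofReal (s - N * (s - 1)) * ∫⁻ x, w x ^ s ∂μ)) := by
    refine ENNReal.Tendsto.const_mul ?_ (Or.inr ofReal_ne_top)
    refine lintegral_tendsto_of_tendsto_of_monotone (fun k => by fun_prop)
      (.of_forall fun x k l hkl => ?_) (.of_forall fun x => ?_)
    · dsimp only
      gcongr
    · obtain ⟨k, hk⟩ := exists_nat_ge (w x).toReal
      refine tendsto_const_nhds.congr' ?_
      filter_upwards [Filter.eventually_ge_atTop k] with l hl
      have : w x ≤ ENNReal.ofReal (l + 1) := by
        rw [← ofReal_toReal (hwtop x)]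
        refine ofReal_le_ofReal (hk.trans ?_)
        have : (k : ℝ) ≤ l := by exact_mod_cast hl
        linarith
      rw [min_eq_left this]
      conv_lhs => rw [show s = 1 + (s - 1) by ring,
        rpow_add_of_nonneg _ _ zero_le_one hs0.le, rpow_one]
  refine le_of_tendsto' hlim fun k => le_trans ?_ (htrunc (k + 1) (by positivity))
  gcongr ENNReal.ofReal (s - N * (s - 1)) * ?_
  refine lintegral_mono_ae ?_
  filter_upwards [hwG] with x hx
  gcongr

/-- The average of `f` over the intersection of the rectangles `Icc c d` and `Icc a b`. -/
def boxAverage {n : ℕ} (a b : Fin n → ℝ) (f : (Fin n → ℝ) → ℝ≥0∞) (c d : Fin n → ℝ) : ℝ≥0∞ :=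
  (volume (Icc c d ∩ Icc a b))⁻¹ * ∫⁻ y in Icc c d ∩ Icc a b, f y

/-- The strong maximal function relative to the rectangle `Icc a b`. -/
def boxMaximal {n : ℕ} (a b : Fin n → ℝ) (f : (Fin n → ℝ) → ℝ≥0∞) (x : Fin n → ℝ) : ℝ≥0∞ :=
  ⨆ (c : Fin n → ℝ) (d : Fin n → ℝ) (_ : x ∈ univ.pi fun i => Ioo (c i) (d i)), boxAverage a b f c d

theorem boxAverage_le_boxMaximal {n : ℕ} {a b : Fin n → ℝ} {f : (Fin n → ℝ) → ℝ≥0∞}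
    {c d x : Fin n → ℝ} (hx : x ∈ univ.pi fun i => Ioo (c i) (d i)) :
    boxAverage a b f c d ≤ boxMaximal a b f x :=
  le_iSup_of_le c <| le_iSup_of_le d <| le_iSup_of_le hx le_rfl

theorem lt_boxMaximal_iff {n : ℕ} {a b : Fin n → ℝ} {f : (Fin n → ℝ) → ℝ≥0∞}
    {x : Fin n → ℝ} {t : ℝ≥0∞} : t < boxMaximal a b f x ↔
      ∃ c d : Fin n → ℝ, (x ∈ univ.pi fun i => Ioo (c i) (d i)) ∧ t < boxAverage a b f c d := by
  simp only [boxMaximal, lt_iSup_iff, exists_prop]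

theorem isOpen_lt_boxMaximal {n : ℕ} (a b : Fin n → ℝ) (f : (Fin n → ℝ) → ℝ≥0∞) (t : ℝ≥0∞) :
    IsOpen {x | t < boxMaximal a b f x} := by
  have : {x | t < boxMaximal a b f x} = ⋃ (c : Fin n → ℝ) (d : Fin n → ℝ)
      (_ : t < boxAverage a b f c d), univ.pi fun i => Ioo (c i) (d i) := by
    ext x
    simp only [mem_iUnion, exists_prop]
    change t < boxMaximal a b f x ↔ _
    rw [lt_boxMaximal_iff]
    simp only [and_comm]
  rw [this]
  exact isOpen_iUnion fun c => isOpen_iUnion fun d => isOpen_iUnion fun _ =>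
    isOpen_set_pi finite_univ fun i _ => isOpen_Ioo

theorem measurable_boxMaximal {n : ℕ} (a b : Fin n → ℝ) (f : (Fin n → ℝ) → ℝ≥0∞) :
    Measurable (boxMaximal a b f) :=
  measurable_of_Ioi fun t => (isOpen_lt_boxMaximal a b f t).measurableSet

theorem boxMaximal_iSup_le {n : ℕ} {a b : Fin n → ℝ} {f : ℕ → (Fin n → ℝ) → ℝ≥0∞}
    (hf : ∀ k, Measurable (f k)) (hmono : Monotone f) (x : Fin n → ℝ) :
    boxMaximal a b (fun y => ⨆ k, f k y) x ≤ ⨆ k, boxMaximal a b (f k) x := by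
  refine iSup_le fun c => iSup_le fun d => iSup_le fun hx => ?_
  rw [boxAverage, lintegral_iSup hf hmono, ENNReal.mul_iSup]
  exact iSup_mono fun k => boxAverage_le_boxMaximal (f := f k) hx

theorem boxMaximal_mono {n : ℕ} {a b : Fin n → ℝ} {f g : (Fin n → ℝ) → ℝ≥0∞} (h : f ≤ g)
    (x : Fin n → ℝ) : boxMaximal a b f x ≤ boxMaximal a b g x := by
  refine iSup_le fun c => iSup_le fun d => iSup_le fun hx => le_trans ?_
    (boxAverage_le_boxMaximal hx)
  exact mul_le_mul_right (lintegral_mono h) _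

theorem ae_mem_Ioo_of_mem_Icc {n : ℕ} (c d : Fin n → ℝ) :
    ∀ᵐ y : Fin n → ℝ, y ∈ Icc c d → y ∈ univ.pi fun i => Ioo (c i) (d i) := by
  have h := Measure.univ_pi_Ioo_ae_eq_Icc (μ := fun _ : Fin n => (volume : Measure ℝ))
    (f := c) (g := d)
  rw [← volume_pi] at h
  filter_upwards [h.mem_iff] with y hy using hy.2

/-- On a superlevel set, the maximal function does not see the values outside of that set. -/
theorem boxMaximal_le_boxMaximal_indicator {n : ℕ} {a b : Fin n → ℝ}
    {f : (Fin n → ℝ) → ℝ≥0∞} {t : ℝ≥0∞} {E : Set (Fin n → ℝ)}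
    (hE : E = Icc a b ∩ {x | t < boxMaximal a b f x}) {x : Fin n → ℝ} (hx : x ∈ E) :
    boxMaximal a b f x ≤ boxMaximal a b (E.indicator f) x := by
  have key : ∀ c d : Fin n → ℝ, (x ∈ univ.pi fun i => Ioo (c i) (d i)) →
      t < boxAverage a b f c d → boxAverage a b f c d ≤ boxMaximal a b (E.indicator f) x := by
    intro c d hx' ht
    refine le_trans (le_of_eq ?_) (boxAverage_le_boxMaximal hx')
    rw [boxAverage, boxAverage]
    congr 1
    refine lintegral_congr_ae ?_
    filter_upwards [ae_restrict_of_ae (ae_mem_Ioo_of_mem_Icc c d),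
      ae_restrict_mem (measurableSet_Icc.inter measurableSet_Icc)] with y hy hyQ
    refine (indicator_of_mem ?_ f).symm
    rw [hE]
    exact ⟨hyQ.2, ht.trans_le (boxAverage_le_boxMaximal (hy hyQ.1))⟩
  have hx' := hx
  rw [hE] at hx'
  obtain ⟨c₀, d₀, hx₀, ht₀⟩ := lt_boxMaximal_iff.1 hx'.2
  refine iSup_le fun c => iSup_le fun d => iSup_le fun hcd => ?_
  rcases lt_or_ge t (boxAverage a b f c d) with h | h
  · exact key c d hcd h
  · exact h.trans (ht₀.le.trans (key c₀ d₀ hx₀ ht₀))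

theorem volume_Icc_pos {n : ℕ} {c d : Fin n → ℝ} (h : ∀ i, c i < d i) : volume (Icc c d) ≠ 0 := by
  rw [Real.volume_Icc_pi, Finset.prod_ne_zero_iff]
  exact fun i _ => (ofReal_pos.2 (sub_pos.2 (h i))).ne'

theorem volume_Icc_ne_top {n : ℕ} (c d : Fin n → ℝ) : volume (Icc c d) ≠ ∞ :=
  isCompact_Icc.measure_lt_top.ne

theorem sup_lt_inf_of_mem {n : ℕ} {a b c d x : Fin n → ℝ} (hab : ∀ i, a i < b i)
    (hx : x ∈ Icc a b) (hxc : x ∈ univ.pi fun i => Ioo (c i) (d i)) (i : Fin n) :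
    (c ⊔ a) i < (d ⊓ b) i := by
  have h1 := hxc i (mem_univ i)
  exact max_lt (lt_min (h1.1.trans h1.2) (h1.1.trans_le (hx.2 i)))
    (lt_min ((hx.1 i).trans_lt h1.2) (hab i))

theorem boxMaximal_le_strongMaximal {n : ℕ} {a b : Fin n → ℝ} (hab : ∀ i, a i < b i)
    {f : (Fin n → ℝ) → ℝ} (hf : Measurable f) {C : ℝ} (hC : ∀ x, |f x| ≤ C)
    {x : Fin n → ℝ} (hx : x ∈ Icc a b) :
    boxMaximal a b (fun y => ‖f y‖ₑ) x ≤ ENNReal.ofReal (strongMaximal volume f x) := by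
  refine iSup_le fun c => iSup_le fun d => iSup_le fun hxc => ?_
  have hlt := sup_lt_inf_of_mem hab hx hxc
  have hxQ : x ∈ Icc c d := ⟨fun i => (hxc i (mem_univ i)).1.le, fun i => (hxc i (mem_univ i)).2.le⟩
  have hrect : IsRectangle (Icc c d ∩ Icc a b) :=
    ⟨c ⊔ a, d ⊓ b, hlt, by rw [Icc_inter_Icc, pi_univ_Icc]⟩
  have hvol : volume (Icc c d ∩ Icc a b) ≠ 0 := by
    rw [Icc_inter_Icc]
    exact volume_Icc_pos hlt
  have hvol' : volume (Icc c d ∩ Icc a b) ≠ ∞ := by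
    rw [Icc_inter_Icc]
    exact volume_Icc_ne_top _ _
  have hint : IntegrableOn f (Icc c d ∩ Icc a b) :=
    Measure.integrableOn_of_bounded hvol' hf.aestronglyMeasurable (.of_forall hC)
  have havg : boxAverage a b (fun y => ‖f y‖ₑ) c d =
      ENNReal.ofReal (rAvg volume (fun y => |f y|) (Icc c d ∩ Icc a b)) := by
    rw [rAvg, boxAverage, ofReal_mul (by positivity), ← toReal_inv,
      ofReal_toReal (inv_ne_top.2 hvol)]
    congr 1
    exact (ofReal_integral_norm_eq_lintegral_enorm hint).symm
  rw [havg]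
  refine ofReal_le_ofReal ?_
  refine le_ciSup (f := fun R : {R : Set (Fin n → ℝ) // IsRectangle R ∧ x ∈ R ∧ volume R ≠ 0} =>
    rAvg volume (fun y => |f y|) R.1) ⟨C, ?_⟩ ⟨_, hrect, ⟨hxQ, hx⟩, hvol⟩
  rintro _ ⟨⟨R, ⟨c', d', _, rfl⟩, _, hR0⟩, rfl⟩
  dsimp only
  rw [pi_univ_Icc] at hR0 ⊢
  have hpos : 0 < (volume (Icc c' d')).toReal := toReal_pos hR0 (volume_Icc_ne_top _ _)
  rw [rAvg, inv_mul_le_iff₀ hpos]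
  refine (le_abs_self _).trans ?_
  have := norm_setIntegral_le_of_norm_le_const (μ := volume) (s := Icc c' d')
    (f := fun y => |f y|) (C := C) (volume_Icc_ne_top _ _).lt_top (fun y _ => by simpa using hC y)
  rw [mul_comm]
  exact this

/-- A rectangle on which `w` has mean greater than `t` lies in the superlevel set at height `t`. -/
theorem Icc_subset_lt_boxMaximal {n : ℕ} {a b c d : Fin n → ℝ} (hab : ∀ i, a i < b i)
    {w : (Fin n → ℝ) → ℝ} (hw0 : ∀ x, 0 < w x) (hw : IntegrableOn w (Icc a b))
    (hs : Icc c d ⊆ Icc a b) {t : ℝ} (ht : 0 ≤ t) (hpos : 0 < ∫ y in Icc c d, (w y - t)) :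
    Icc c d ⊆ {x | ENNReal.ofReal t < boxMaximal a b (fun y => ENNReal.ofReal (w y)) x} := by
  have hconst : IntegrableOn (fun _ : Fin n → ℝ => t) (Icc a b) :=
    integrableOn_const (volume_Icc_ne_top a b)
  have hlim := tendsto_setIntegral_of_antitone (μ := volume) (f := fun y => w y - t)
    (s := fun k : ℕ => Icc (fun i => c i - 1 / ((k : ℝ) + 1)) (fun i => d i + 1 / ((k : ℝ) + 1)) ∩
      Icc a b)
    (fun k => measurableSet_Icc.inter measurableSet_Icc)
    (fun k l hkl => by
      have : 1 / ((l : ℝ) + 1) ≤ 1 / ((k : ℝ) + 1) :=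
        one_div_le_one_div_of_le (by positivity) (by gcongr)
      refine inter_subset_inter_left _ (Icc_subset_Icc (fun i => ?_) (fun i => ?_))
      · dsimp only; linarith
      · dsimp only; linarith)
    ⟨0, (hw.sub hconst).mono_set inter_subset_right⟩
  have hinter : ⋂ k : ℕ, Icc (fun i => c i - 1 / ((k : ℝ) + 1)) (fun i => d i + 1 / ((k : ℝ) + 1)) ∩
      Icc a b = Icc c d := by
    refine Subset.antisymm (fun y hy => ?_) (fun y hy => mem_iInter.2 fun k => ⟨⟨fun i => ?_, fun i => ?_⟩, hs hy⟩)
    · rw [mem_iInter] at hy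
      refine ⟨fun i => le_of_forall_pos_le_add fun ε hε => ?_,
        fun i => le_of_forall_pos_le_add fun ε hε => ?_⟩
      · obtain ⟨k, hk⟩ := exists_nat_one_div_lt hε
        have := (hy k).1.1 i
        dsimp only at this
        linarith
      · obtain ⟨k, hk⟩ := exists_nat_one_div_lt hε
        have := (hy k).1.2 i
        dsimp only at this
        linarith
    · have := hy.1 i
      have : 0 < 1 / ((k : ℝ) + 1) := by positivity
      dsimp only
      linarith
    · have := hy.2 i
      have : 0 < 1 / ((k : ℝ) + 1) := by positivity
      dsimp only
      linarith
  rw [hinter] at hlim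
  obtain ⟨k, hk⟩ := (hlim.eventually (lt_mem_nhds hpos)).exists
  intro x hx
  have hδ : 0 < 1 / ((k : ℝ) + 1) := by positivity
  have hxk : x ∈ univ.pi fun i => Ioo (c i - 1 / ((k : ℝ) + 1)) (d i + 1 / ((k : ℝ) + 1)) :=
    fun i _ => ⟨by linarith [hx.1 i], by linarith [hx.2 i]⟩
  refine lt_boxMaximal_iff.2 ⟨_, _, hxk, ?_⟩
  have hlt := sup_lt_inf_of_mem hab (hs hx) hxk
  set Q := Icc (fun i => c i - 1 / ((k : ℝ) + 1)) (fun i => d i + 1 / ((k : ℝ) + 1)) ∩ Icc a b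
    with hQ
  have hvol : volume Q ≠ 0 := by
    rw [hQ, Icc_inter_Icc]
    exact volume_Icc_pos hlt
  have hvol' : volume Q ≠ ∞ := by
    rw [hQ, Icc_inter_Icc]
    exact volume_Icc_ne_top _ _
  have hwQ : IntegrableOn w Q := hw.mono_set inter_subset_right
  rw [integral_sub hwQ (hconst.mono_set inter_subset_right), setIntegral_const, smul_eq_mul,
    sub_pos] at hk
  rw [boxAverage, ← hQ, mul_comm, ← div_eq_mul_inv,
    ENNReal.lt_div_iff_mul_lt (Or.inl hvol) (Or.inl hvol'),
    ← ofReal_integral_eq_lintegral_ofReal hwQ (.of_forall fun x => (hw0 x).le),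
    ← ofReal_toReal hvol', ← ofReal_mul ht]
  refine (ofReal_lt_ofReal_iff_of_nonneg (by positivity)).2 ?_
  rw [mul_comm]
  exact hk

theorem ae_le_boxMaximal {n : ℕ} {a b : Fin n → ℝ} {f : (Fin n → ℝ) → ℝ≥0∞}
    (hf : Measurable f) (hfin : ∫⁻ x in Icc a b, f x ≠ ∞) :
    f ≤ᵐ[volume.restrict (Icc a b)] boxMaximal a b f := by
  have h := (Besicovitch.vitaliFamily (volume : Measure (Fin n → ℝ))).ae_tendsto_lintegral_div
    (f := (Icc a b).indicator f) (hf.indicator measurableSet_Icc).aemeasurable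
    (by rwa [lintegral_indicator measurableSet_Icc])
  filter_upwards [ae_restrict_of_ae h, ae_restrict_mem measurableSet_Icc] with x hx hxR
  have hlim := hx.comp (Besicovitch.tendsto_filterAt volume x)
  rw [indicator_of_mem hxR] at hlim
  refine le_of_tendsto hlim ?_
  filter_upwards [self_mem_nhdsWithin] with r (hr : 0 < r)
  have hball : Metric.closedBall x r = Icc (fun i => x i - r) (fun i => x i + r) := by
    rw [closedBall_pi _ hr.le, ← pi_univ_Icc]
    simp only [Real.closedBall_eq_Icc]
  refine le_trans ?_ (boxAverage_le_boxMaximal (c := fun i => x i - r) (d := fun i => x i + r)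
    fun i _ => ⟨by linarith, by linarith⟩)
  rw [Function.comp_apply, hball, boxAverage, setLIntegral_indicator measurableSet_Icc,
    inter_comm (Icc a b), div_eq_mul_inv, mul_comm]
  gcongr
  exact inter_subset_left

theorem eLpNorm_strongMaximal_le {n : ℕ} {ν m : Measure (Fin n → ℝ)} {q : ℝ}
    (h0 : opNormMs ν m q ≠ 0) (htop : opNormMs ν m q ≠ ∞) (f : (Fin n → ℝ) → ℝ) :
    eLpNorm (strongMaximal ν f) (ENNReal.ofReal q) m ≤
      opNormMs ν m q * eLpNorm f (ENNReal.ofReal q) m := by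
  by_cases hf : eLpNorm f (ENNReal.ofReal q) m = ∞
  · rw [hf, mul_top h0]
    exact le_top
  by_cases hf0 : eLpNorm f (ENNReal.ofReal q) m = 0
  · obtain ⟨c, hc, -⟩ := sInf_lt_iff.1 (lt_top_iff_ne_top.2 htop)
    have := hc f
    rw [hf0, mul_zero] at this ⊢
    exact this
  rw [← ENNReal.div_le_iff hf0 hf]
  exact le_sInf fun c hc => (ENNReal.div_le_iff hf0 hf).2 (hc f)

/-- Duality: boundedness of the strong maximal function on `L^{p'}(σ)` tested on `w 1_A`. -/
theorem setLIntegral_boxMaximal_le_of_bounded {n : ℕ} {p q N : ℝ} (hpq : q.HolderConjugate p)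
    {w : (Fin n → ℝ) → ℝ} (hw0 : ∀ x, 0 < w x) (hwm : Measurable w)
    (hbound : ∀ f : (Fin n → ℝ) → ℝ,
      eLpNorm (strongMaximal volume f) (ENNReal.ofReal q)
          (volume.withDensity fun x => ENNReal.ofReal (w x ^ (1 - q))) ≤
        ENNReal.ofReal N * eLpNorm f (ENNReal.ofReal q)
          (volume.withDensity fun x => ENNReal.ofReal (w x ^ (1 - q))))
    {a b : Fin n → ℝ} (hab : ∀ i, a i < b i) {A : Set (Fin n → ℝ)} (hA : MeasurableSet A)
    (hAR : A ⊆ Icc a b) {C : ℝ} (hC : ∀ x ∈ A, w x ≤ C) :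
    ∫⁻ x in A, boxMaximal a b (A.indicator fun y => ENNReal.ofReal (w y)) x ≤
      ENNReal.ofReal N * ∫⁻ x in A, ENNReal.ofReal (w x) := by
  set W : (Fin n → ℝ) → ℝ≥0∞ := fun y => ENNReal.ofReal (w y) with hW
  set G := boxMaximal a b (A.indicator W) with hG
  have hGm : Measurable G := measurable_boxMaximal _ _ _
  have hWm : Measurable W := hwm.ennreal_ofReal
  have hW0 : ∀ x, W x ≠ 0 := fun x => (ofReal_pos.2 (hw0 x)).ne'
  have hWt : ∀ x, W x ≠ ∞ := fun x => ofReal_ne_top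
  have hq := hpq.pos
  have hp := hpq.symm.pos
  have hσ : (fun x => ENNReal.ofReal (w x ^ (1 - q))) = fun x => W x ^ (1 - q) := by
    ext x
    rw [hW, ofReal_rpow_of_pos (hw0 x)]
  have hqE : ENNReal.ofReal q ≠ 0 := (ofReal_pos.2 hq).ne'
  have htest := hbound (A.indicator w)
  have henorm : (fun y => ‖A.indicator w y‖ₑ) = A.indicator W := by
    ext y
    by_cases hy : y ∈ A
    · simp [hy, hW, Real.enorm_of_nonneg (hw0 y).le]
    · simp [hy]
  have hsm : ∀ x, A.indicator G x ≤ ‖strongMaximal volume (A.indicator w) x‖ₑ := by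
    intro x
    by_cases hx : x ∈ A
    · rw [indicator_of_mem hx, hG, ← henorm]
      refine (boxMaximal_le_strongMaximal hab (hwm.indicator hA) (C := max C 0) ?_
        (hAR hx)).trans (Real.ofReal_le_enorm _)
      intro y
      by_cases hy : y ∈ A
      · rw [indicator_of_mem hy, abs_of_pos (hw0 y)]
        exact (hC y hy).trans (le_max_left _ _)
      · simp [indicator_of_notMem hy]
    · simp [indicator_of_notMem hx]
  rw [eLpNorm_eq_lintegral_rpow_enorm_toReal hqE ofReal_ne_top,
    eLpNorm_eq_lintegral_rpow_enorm_toReal hqE ofReal_ne_top, toReal_ofReal hq.le, hσ] at htest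
  have hind : ∀ g : (Fin n → ℝ) → ℝ≥0∞, Measurable g →
      ∫⁻ x, A.indicator g x ^ q ∂(volume.withDensity fun x => W x ^ (1 - q)) =
        ∫⁻ x in A, W x ^ (1 - q) * g x ^ q := by
    intro g hg
    rw [lintegral_withDensity_eq_lintegral_mul _ (by fun_prop)
      ((hg.indicator hA).pow_const q), ← lintegral_indicator hA]
    refine lintegral_congr fun x => ?_
    by_cases hx : x ∈ A
    · simp [hx]
    · simp [hx, hq]
  have hleft : (∫⁻ x in A, W x ^ (1 - q) * G x ^ q) ^ (1 / q) ≤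
      ENNReal.ofReal N * (∫⁻ x in A, W x) ^ (1 / q) := by
    calc (∫⁻ x in A, W x ^ (1 - q) * G x ^ q) ^ (1 / q)
        = (∫⁻ x, A.indicator G x ^ q ∂(volume.withDensity fun x => W x ^ (1 - q))) ^ (1 / q) := by
          rw [hind G hGm]
      _ ≤ (∫⁻ x, ‖strongMaximal volume (A.indicator w) x‖ₑ ^ q
            ∂(volume.withDensity fun x => W x ^ (1 - q))) ^ (1 / q) :=
          rpow_le_rpow (lintegral_mono fun x => rpow_le_rpow (hsm x) hq.le) (by positivity)
      _ ≤ _ := htest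
      _ = ENNReal.ofReal N * (∫⁻ x in A, W x) ^ (1 / q) := by
          have h1 : ∀ x, ‖A.indicator w x‖ₑ ^ q = A.indicator W x ^ q := fun x => by
            rw [← henorm]
          rw [lintegral_congr h1, hind W hWm]
          congr 3
          ext x
          rw [← rpow_add _ _ (hW0 x) (hWt x)]
          simp
  have hholder := ENNReal.lintegral_mul_le_Lp_mul_Lq (volume.restrict A) hpq
    (f := fun x => G x * W x ^ ((1 - q) / q)) (g := fun x => W x ^ (1 / p))
    (by fun_prop) (by fun_prop)
  have hsum := hpq.inv_add_inv_eq_one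
  calc ∫⁻ x in A, G x
      = ∫⁻ x in A, ((fun x => G x * W x ^ ((1 - q) / q)) * fun x => W x ^ (1 / p)) x := by
        refine lintegral_congr fun x => ?_
        rw [Pi.mul_apply, mul_assoc, ← rpow_add _ _ (hW0 x) (hWt x)]
        have : (1 - q) / q + 1 / p = 0 := by
          rw [sub_div, div_self hq.ne', one_div, one_div]
          linarith
        rw [this, rpow_zero, mul_one]
    _ ≤ _ := hholder
    _ = (∫⁻ x in A, W x ^ (1 - q) * G x ^ q) ^ (1 / q) * (∫⁻ x in A, W x) ^ (1 / p) := by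
        congr 2
        · refine lintegral_congr fun x => ?_
          rw [mul_rpow_of_nonneg _ _ hq.le, ← rpow_mul, div_mul_cancel₀ _ hq.ne', mul_comm]
        · refine lintegral_congr fun x => ?_
          rw [← rpow_mul, one_div, inv_mul_cancel₀ hp.ne', rpow_one]
    _ ≤ ENNReal.ofReal N * (∫⁻ x in A, W x) ^ (1 / q) * (∫⁻ x in A, W x) ^ (1 / p) := by
        gcongr
    _ = ENNReal.ofReal N * ∫⁻ x in A, W x := by
        rw [mul_assoc, ← rpow_add_of_nonneg _ _ (by positivity) (by positivity), one_div, one_div,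
          hsum, rpow_one]

theorem setLIntegral_boxMaximal_le {n : ℕ} {p q N : ℝ} (hpq : q.HolderConjugate p)
    {w : (Fin n → ℝ) → ℝ} (hw0 : ∀ x, 0 < w x) (hwm : Measurable w)
    (hbound : ∀ f : (Fin n → ℝ) → ℝ,
      eLpNorm (strongMaximal volume f) (ENNReal.ofReal q)
          (volume.withDensity fun x => ENNReal.ofReal (w x ^ (1 - q))) ≤
        ENNReal.ofReal N * eLpNorm f (ENNReal.ofReal q)
          (volume.withDensity fun x => ENNReal.ofReal (w x ^ (1 - q))))
    {a b : Fin n → ℝ} (hab : ∀ i, a i < b i) {E : Set (Fin n → ℝ)} (hE : MeasurableSet E)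
    (hER : E ⊆ Icc a b) :
    ∫⁻ x in E, boxMaximal a b (E.indicator fun y => ENNReal.ofReal (w y)) x ≤
      ENNReal.ofReal N * ∫⁻ x in E, ENNReal.ofReal (w x) := by
  set W : (Fin n → ℝ) → ℝ≥0∞ := fun y => ENNReal.ofReal (w y) with hW
  have hWm : Measurable W := hwm.ennreal_ofReal
  set A : ℕ → Set (Fin n → ℝ) := fun k => E ∩ {x | w x ≤ k} with hA
  have hAm : ∀ k, MeasurableSet (A k) := fun k =>
    hE.inter (measurableSet_le hwm measurable_const)
  have hAmono : Monotone A := fun k l hkl =>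
    inter_subset_inter_right _ fun x (hx : w x ≤ k) => hx.trans (by exact_mod_cast hkl)
  have hmono : Monotone fun k => (A k).indicator W := fun k l hkl =>
    indicator_le_indicator_of_subset (hAmono hkl) fun _ => zero_le
  have hsup : E.indicator W = fun y => ⨆ k, (A k).indicator W y := by
    ext y
    refine le_antisymm ?_ (iSup_le fun k =>
      indicator_le_indicator_of_subset inter_subset_left (fun _ => zero_le) y)
    by_cases hy : y ∈ E
    · obtain ⟨k, hk⟩ := exists_nat_ge (w y)
      refine le_iSup_of_le k ?_
      rw [indicator_of_mem hy, indicator_of_mem (show y ∈ A k from ⟨hy, hk⟩)]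
    · simp [indicator_of_notMem hy]
  calc ∫⁻ x in E, boxMaximal a b (E.indicator W) x
      ≤ ∫⁻ x in E, ⨆ k, (A k).indicator (boxMaximal a b ((A k).indicator W)) x := by
        refine setLIntegral_mono' hE fun x hx => ?_
        rw [hsup]
        refine (boxMaximal_iSup_le (fun k => hWm.indicator (hAm k)) hmono x).trans
          (iSup_le fun k => ?_)
        obtain ⟨l, hl⟩ := exists_nat_ge (w x)
        have hxA : x ∈ A (max k l) := hAmono (le_max_right k l) ⟨hx, hl⟩
        refine le_iSup_of_le (max k l) ?_
        rw [indicator_of_mem hxA]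
        exact boxMaximal_mono (hmono (le_max_left k l)) x
    _ = ⨆ k, ∫⁻ x in E, (A k).indicator (boxMaximal a b ((A k).indicator W)) x := by
        refine lintegral_iSup (fun k => (measurable_boxMaximal _ _ _).indicator (hAm k)) ?_
        intro k l hkl x
        refine (indicator_le_indicator_of_subset (hAmono hkl) (fun _ => zero_le) x).trans ?_
        exact indicator_le_indicator (boxMaximal_mono (hmono hkl) x)
    _ ≤ ENNReal.ofReal N * ∫⁻ x in E, W x := by
        refine iSup_le fun k => ?_
        have hAE : A k ⊆ E := inter_subset_left
        rw [setLIntegral_indicator (hAm k), inter_eq_left.2 hAE]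
        refine (setLIntegral_boxMaximal_le_of_bounded hpq hw0 hwm hbound hab (hAm k)
          (hAE.trans hER) (C := k) fun x hx => hx.2).trans ?_
        gcongr

/-- Local integrability range for strong `A*_p` weights (Lebesgue measure) in terms of
the operator norm `N = ‖M_s‖_{L^{p'}(σ)}`. -/
theorem AStarP_integrability_maximal (n : ℕ) (p : ℝ) (hp : 1 < p)
    (w : (Fin n → ℝ) → ℝ) (hw0 : ∀ x, 0 < w x) (hwm : Measurable w)
    (hloc : ∀ R : Set (Fin n → ℝ), IsRectangle R → IntegrableOn w R volume)
    (cw : ℝ) (hw : IsAStarP volume w p cw)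
    (σ : (Fin n → ℝ) → ℝ) (hσ : σ = fun x => w x ^ (1 - p / (p - 1)))
    (N : ℝ)
    (hN : N = (opNormMs volume
      (volume.withDensity fun x => ENNReal.ofReal (σ x)) (p / (p - 1))).toReal)
    (s : ℝ) (hs1 : 1 < s) (hs2 : s < N / (N - 1))
    (R : Set (Fin n → ℝ)) (hR : IsRectangle R) (hμR : volume R ≠ 0) :
    rAvg volume (fun x => w x ^ s) R ≤
      (s / (1 - (s - 1) * (N - 1))) * rAvg volume w R ^ s := by
  obtain ⟨a, b, hab, rfl⟩ := hR
  have hwR := hloc _ ⟨a, b, hab, rfl⟩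
  rw [pi_univ_Icc] at hμR hwR ⊢
  set q := p / (p - 1) with hq
  have hpq : q.HolderConjugate p := (Real.HolderConjugate.conjExponent hp).symm
  have hN1 : 1 < N := by
    by_contra! hle
    have : N / (N - 1) ≤ 0 := by
      refine div_nonpos_of_nonneg_of_nonpos ?_ (by linarith)
      rw [hN]
      exact toReal_nonneg
    linarith
  have hNs : 0 < s - N * (s - 1) := by
    rw [lt_div_iff₀ (by linarith)] at hs2
    linarith
  subst hσ
  have htop : opNormMs volume (volume.withDensity fun x => ENNReal.ofReal (w x ^ (1 - q))) q ≠ ∞ := by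
    intro h
    rw [h, toReal_top] at hN
    linarith
  have h0 : opNormMs volume (volume.withDensity fun x => ENNReal.ofReal (w x ^ (1 - q))) q ≠ 0 := by
    intro h
    rw [h, toReal_zero] at hN
    linarith
  have hbound := eLpNorm_strongMaximal_le h0 htop
  rw [← ofReal_toReal htop, ← hN] at hbound
  set W : (Fin n → ℝ) → ℝ≥0∞ := fun y => ENNReal.ofReal (w y) with hW
  have hWm : Measurable W := hwm.ennreal_ofReal
  have hGm := measurable_boxMaximal a b W
  set V := (volume (Icc a b)).toReal with hV
  have hVt := volume_Icc_ne_top a b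
  have hVpos : 0 < V := toReal_pos hμR hVt
  set L := rAvg volume w (Icc a b) with hL
  have hwpos : 0 < ∫ x in Icc a b, w x := by
    rw [setIntegral_pos_iff_support_of_nonneg_ae (.of_forall fun x => (hw0 x).le) hwR,
      Function.support_eq_univ fun x => (hw0 x).ne', univ_inter]
    exact pos_iff_ne_zero.2 hμR
  have hLpos : 0 < L := mul_pos (inv_pos.2 hVpos) hwpos
  have hwLV : ∫ x in Icc a b, w x = L * V := by
    rw [hL, rAvg, ← hV]
    field_simp
  have hlint : ∀ S ⊆ Icc a b, ∫⁻ x in S, W x = ENNReal.ofReal (∫ x in S, w x) := fun S hS =>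
    (ofReal_integral_eq_lintegral_ofReal (hwR.mono_set hS)
      (.of_forall fun x => (hw0 x).le)).symm
  have hrestrict : ∀ t : ℝ≥0∞, (volume.restrict (Icc a b)).restrict {x | t < boxMaximal a b W x} =
      volume.restrict (Icc a b ∩ {x | t < boxMaximal a b W x}) := fun t => by
    rw [Measure.restrict_restrict (isOpen_lt_boxMaximal a b W t).measurableSet, inter_comm]
  have : IsFiniteMeasure (volume.restrict (Icc a b)) := ⟨by simpa using hVt.lt_top⟩
  have hmain := lintegral_rpow_le_of_superlevel (μ := volume.restrict (Icc a b)) hWm hGm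
    (fun x => ofReal_ne_top)
    (ae_le_boxMaximal hWm (by rw [hlint _ subset_rfl]; exact ofReal_ne_top)) hLpos
    (by linarith : 0 ≤ N) hs1 hNs
    (by
      rw [hlint _ subset_rfl, hwLV, ofReal_mul hLpos.le, Measure.restrict_apply_univ, hV,
        ofReal_toReal hVt])
    (by
      intro t
      have hEm : MeasurableSet (Icc a b ∩ {x | ENNReal.ofReal t < boxMaximal a b W x}) :=
        measurableSet_Icc.inter (isOpen_lt_boxMaximal a b W _).measurableSet
      rw [hrestrict]
      refine le_trans (setLIntegral_mono' hEm fun x hx => ?_)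
        (setLIntegral_boxMaximal_le hpq hw0 hwm hbound hab hEm inter_subset_left)
      exact boxMaximal_le_boxMaximal_indicator rfl hx)
    (by
      intro t hLt
      have ht : 0 < t := hLpos.trans_le hLt
      have hU := isOpen_lt_boxMaximal a b W (ENNReal.ofReal t)
      have hconst : IntegrableOn (fun _ : Fin n → ℝ => t) (Icc a b) := integrableOn_const hVt
      have hkey := setIntegral_nonpos_of_rectangles hab hU rfl (hwR.sub hconst)
        (by
          simp only [Pi.sub_apply]
          rw [integral_sub hwR hconst, setIntegral_const, smul_eq_mul, hwLV, Measure.real, ← hV,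
            mul_comm L, ← mul_sub]
          exact mul_nonpos_of_nonneg_of_nonpos hVpos.le (by linarith))
        (fun c d _ hs hn => by
          by_contra! hpos
          exact hn fun x hx => ⟨hs hx, Icc_subset_lt_boxMaximal hab hw0 hwR hs ht.le hpos hx⟩)
      set E := Icc a b ∩ {x | ENNReal.ofReal t < boxMaximal a b W x} with hE
      have hER : E ⊆ Icc a b := inter_subset_left
      have hEt : volume E ≠ ∞ := measure_ne_top_of_subset hER hVt
      simp only [Pi.sub_apply] at hkey
      rw [integral_sub (hwR.mono_set hER) (hconst.mono_set hER), setIntegral_const, smul_eq_mul,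
        sub_nonpos] at hkey
      rw [hrestrict, Measure.restrict_apply hU.measurableSet, inter_comm _ (Icc a b), ← hE,
        hlint E hER, ← ofReal_toReal hEt, ← ofReal_mul ht.le, mul_comm t]
      exact ofReal_le_ofReal hkey)
  have hWs : ∫⁻ x in Icc a b, W x ^ s = ∫⁻ x in Icc a b, ENNReal.ofReal (w x ^ s) :=
    lintegral_congr fun x => ofReal_rpow_of_pos (hw0 x)
  rw [hWs, Measure.restrict_apply_univ, ← ofReal_toReal hVt, ← ofReal_mul (by positivity)] at hmain
  have hint : ∫ x in Icc a b, w x ^ s =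
      (∫⁻ x in Icc a b, ENNReal.ofReal (w x ^ s)).toReal :=
    integral_eq_lintegral_of_nonneg_ae (.of_forall fun x => (Real.rpow_pos_of_pos (hw0 x) s).le)
      (hwm.pow_const s).aestronglyMeasurable
  have hreal := toReal_mono ofReal_ne_top hmain
  rw [toReal_mul, toReal_ofReal hNs.le, toReal_ofReal (by positivity), ← hint, ← hV] at hreal
  have hden : 1 - (s - 1) * (N - 1) = s - N * (s - 1) := by ring
  rw [hden, rAvg, ← hV, inv_mul_le_iff₀ hVpos, div_mul_eq_mul_div, mul_div_assoc',
    le_div_iff₀ hNs]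
  linarith
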